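/- (Finite-difference sieve for loop Hafnians.) Let M ≥ 1, let A ∈ ℂ^{2M×2M} be symmetric, let γ ∈ ℂ^{2M}, let n ∈ ℕ^M and N = n_1+⋯+n_M. Regard f_N(A,γ,z) as a polynomial in the variables z_1,…,z_M. Then for any choices of complex parameters u_i ≠ v_i, lhaf(A_{n⊕n}, γ_{n⊕n}) = (Π_{i=1}^M D_{z_i}^{(n_i)}) f_N(A, γ, z). -/

import Mathlib

open Matrix

noncomputable section

/-- The loop Hafnian of a matrix `B`: the sum over all involutions `σ` of `{0,…,d-1}`
of the product over `i ≤ σ i` of `B i (σ i)`. -/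
def lhaf {d : ℕ} (B : Matrix (Fin d) (Fin d) ℂ) : ℂ :=
  ∑ σ ∈ Finset.univ.filter (fun σ : Equiv.Perm (Fin d) => σ * σ = 1),
    ∏ i ∈ Finset.univ.filter (fun i => i ≤ σ i), B i (σ i)

/-- `filldiag A γ` is `A` with its diagonal overwritten by the entries of `γ`. -/
def filldiag {d : ℕ} (A : Matrix (Fin d) (Fin d) ℂ) (γ : Fin d → ℂ) :
    Matrix (Fin d) (Fin d) ℂ :=
  Matrix.of fun i j => if i = j then γ i else A i j

/-- `lhaf(A, γ) := lhaf(filldiag(A, γ))`. -/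
def lhafv {d : ℕ} (A : Matrix (Fin d) (Fin d) ℂ) (γ : Fin d → ℂ) : ℂ :=
  lhaf (filldiag A γ)

/-- The list containing `n k` consecutive copies of `k`, for `k = 0, 1, …, M-1` in order. -/
def repList {M : ℕ} (n : Fin M → ℕ) : List (Fin M) :=
  (List.finRange M).flatMap fun k => List.replicate (n k) k

lemma repList_length {M : ℕ} (n : Fin M → ℕ) : (repList n).length = ∑ k, n k := by
  simp only [repList, List.length_flatMap, Fin.sum_univ_def, List.map_map]
  congr 1
  simp [Function.comp]

/-- The repetition map sending each of the `∑ k, n k` indices to the original index of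
which it is a copy (`n k` copies of `k`, in order). -/
def rep {M : ℕ} (n : Fin M → ℕ) (i : Fin (∑ k, n k)) : Fin M :=
  (repList n).get (Fin.cast (repList_length n).symm i)

/-- The doubled repetition map: the first `∑ k, n k` indices are copies of the "left"
indices (`n k` copies of `inl k`), the last `∑ k, m k` are copies of the "right" indices
(`m k` copies of `inr k`). -/
def dbl {M : ℕ} (n m : Fin M → ℕ) :
    Fin ((∑ k, n k) + (∑ k, m k)) → Fin M ⊕ Fin M :=
  (Sum.map (rep n) (rep m)) ∘ finSumFinEquiv.symm

/-- `A_{n⊕m}`: the matrix obtained from a `2M × 2M` matrix `A` (indexed by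
`Fin M ⊕ Fin M`) by taking `n k` copies of the `k`-th row/column and `m k` copies of the
`(M+k)`-th row/column. -/
def repMat {M : ℕ} (A : Matrix (Fin M ⊕ Fin M) (Fin M ⊕ Fin M) ℂ) (n m : Fin M → ℕ) :
    Matrix (Fin ((∑ k, n k) + (∑ k, m k))) (Fin ((∑ k, n k) + (∑ k, m k))) ℂ :=
  A.submatrix (dbl n m) (dbl n m)

/-- `γ_{n⊕m}`: the vector obtained from `γ` by taking `n k` copies of the `k`-th entry and
`m k` copies of the `(M+k)`-th entry. -/
def repVec {M : ℕ} (γ : Fin M ⊕ Fin M → ℂ) (n m : Fin M → ℕ) :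
    Fin ((∑ k, n k) + (∑ k, m k)) → ℂ :=
  γ ∘ dbl n m

/-- The swap matrix `X = [[0, I],[I, 0]]`. -/
def Xmat (ι : Type*) [DecidableEq ι] [Fintype ι] (R : Type*) [CommRing R] :
    Matrix (ι ⊕ ι) (ι ⊕ ι) R :=
  Matrix.fromBlocks 0 1 1 0

/-- `D(z) = diag(z) ⊕ diag(z)`. -/
def Dmat {ι : Type*} [DecidableEq ι] {R : Type*} [CommRing R] (z : ι → R) :
    Matrix (ι ⊕ ι) (ι ⊕ ι) R :=
  Matrix.diagonal (Sum.elim z z)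

/-- `g_k(A,γ,z) = tr((D(z)XA)^k)/(2k) + (1/2)·γᵀ (D(z)XA)^{k-1} D(z)X γ`. -/
def gfun {ι : Type*} [Fintype ι] [DecidableEq ι] {R : Type*} [CommRing R]
    (A : Matrix (ι ⊕ ι) (ι ⊕ ι) R) (γ : ι ⊕ ι → R) (z : ι → R) (k : ℕ) : R :=
  Ring.inverse ((2 * k : ℕ) : R) * Matrix.trace ((Dmat z * Xmat ι R * A) ^ k)
    + Ring.inverse (2 : R) *
        (γ ⬝ᵥ Matrix.mulVec ((Dmat z * Xmat ι R * A) ^ (k - 1) * (Dmat z * Xmat ι R)) γ)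

/-- `f_N(A,γ,z)`: the coefficient of `η^N` in `Σ_{j=0}^N (1/j!)(Σ_{k=1}^N g_k(A,γ,z) η^k)^j`. -/
def fN {ι : Type*} [Fintype ι] [DecidableEq ι] {R : Type*} [CommRing R]
    (N : ℕ) (A : Matrix (ι ⊕ ι) (ι ⊕ ι) R) (γ : ι ⊕ ι → R) (z : ι → R) : R :=
  Polynomial.coeff
    (∑ j ∈ Finset.range (N + 1),
      Polynomial.C (Ring.inverse ((j.factorial : ℕ) : R)) *
        (∑ k ∈ Finset.Icc 1 N, Polynomial.C (gfun A γ z k) * Polynomial.X ^ k) ^ j) N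

/-- Substitute the constant `c` for the variable `i` in a multivariate polynomial,
leaving the other variables untouched. -/
def substVar {n : ℕ} (i : Fin n) (c : ℂ) (P : MvPolynomial (Fin n) ℂ) :
    MvPolynomial (Fin n) ℂ :=
  MvPolynomial.aeval (fun j => if j = i then MvPolynomial.C c else MvPolynomial.X j) P

/-- The `k`-th finite-difference operator in the variable `i`, with parameters `u ≠ v`:
`D_{x_i}^{(k)} P = (u − v)^{−k} Σ_{m=0}^{k} C(k,m) (−1)^{k−m} P|_{x_i = v + m(u − v)}`. -/
def fdiff {n : ℕ} (i : Fin n) (k : ℕ) (u v : ℂ) (P : MvPolynomial (Fin n) ℂ) :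
    MvPolynomial (Fin n) ℂ :=
  MvPolynomial.C (((u - v) ^ k)⁻¹) *
    ∑ m ∈ Finset.range (k + 1),
      MvPolynomial.C ((Nat.choose k m : ℂ) * (-1) ^ (k - m)) *
        substVar i (v + (m : ℂ) * (u - v)) P

/-- scalar finite difference of a power -/
def dl (k a : ℕ) (u v : ℂ) : ℂ :=
  ((u - v) ^ k)⁻¹ * ∑ m ∈ Finset.range (k + 1),
    ((Nat.choose k m : ℂ) * (-1) ^ (k - m)) * (v + (m : ℂ) * (u - v)) ^ a

lemma dl_eq (k a : ℕ) (u v : ℂ) (h : u ≠ v) :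
    dl k a u v = ((u - v) ^ k)⁻¹ * (u - v) ^ a *
      ((fwdDiff (1 : ℂ))^[k] (fun r : ℂ => r ^ a) (v / (u - v))) := by
  have h' : u - v ≠ 0 := sub_ne_zero.mpr h
  rw [fwdDiff_iter_eq_sum_shift, dl, mul_assoc]
  congr 1
  rw [Finset.mul_sum]
  refine Finset.sum_congr rfl fun m _ => ?_
  have : v + (m : ℂ) * (u - v) = (u - v) * (v / (u - v) + m • (1 : ℂ)) := by
    field_simp
    simp [mul_comm]
  rw [this, mul_pow]
  simp only [zsmul_eq_mul]
  push_cast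
  ring

lemma dl_lt {k a : ℕ} (u v : ℂ) (h : u ≠ v) (hk : a < k) : dl k a u v = 0 := by
  rw [dl_eq k a u v h, fwdDiff_iter_pow_eq_zero_of_lt hk]
  simp

lemma dl_self (k : ℕ) (u v : ℂ) (h : u ≠ v) : dl k k u v = (k.factorial : ℂ) := by
  have h' : u - v ≠ 0 := sub_ne_zero.mpr h
  rw [dl_eq k k u v h, fwdDiff_iter_eq_factorial, inv_mul_cancel₀ (pow_ne_zero _ h')]
  simp

lemma substVar_monomial {n : ℕ} (i : Fin n) (x : ℂ) (a : Fin n →₀ ℕ) (c : ℂ) :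
    substVar i x (MvPolynomial.monomial a c) =
      MvPolynomial.monomial (a.erase i) (c * x ^ a i) := by
  rw [substVar, MvPolynomial.aeval_monomial, MvPolynomial.monomial_eq, map_mul,
    Finsupp.prod_fintype _ _ (fun _ => pow_zero _), Finsupp.prod_fintype _ _ (fun _ => pow_zero _),
    ← Finset.mul_prod_erase _ _ (Finset.mem_univ i),
    ← Finset.mul_prod_erase Finset.univ (fun j => _ ^ (a.erase i j)) (Finset.mem_univ i)]
  have : ∀ j ∈ Finset.univ.erase i,
      (if j = i then MvPolynomial.C x else (MvPolynomial.X j : MvPolynomial (Fin n) ℂ)) ^ a j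
        = MvPolynomial.X j ^ (a.erase i j) := by
    intro j hj
    have hj := Finset.ne_of_mem_erase hj
    simp [hj, Finsupp.erase_ne]
  rw [Finset.prod_congr rfl this]
  simp [MvPolynomial.algebraMap_eq, mul_assoc]

lemma fdiff_monomial {n : ℕ} (i : Fin n) (k : ℕ) (u v : ℂ) (a : Fin n →₀ ℕ) (c : ℂ) :
    fdiff i k u v (MvPolynomial.monomial a c) =
      MvPolynomial.monomial (a.erase i) (c * dl k (a i) u v) := by
  simp only [fdiff, substVar_monomial, MvPolynomial.C_mul_monomial]
  rw [← map_sum, MvPolynomial.C_mul_monomial, dl]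
  congr 1
  rw [Finset.mul_sum, Finset.mul_sum, Finset.mul_sum]
  refine Finset.sum_congr rfl fun m _ => ?_
  ring

lemma fdiff_sum {n : ℕ} (i : Fin n) (k : ℕ) (u v : ℂ) {β : Type*} (s : Finset β)
    (P : β → MvPolynomial (Fin n) ℂ) :
    fdiff i k u v (∑ b ∈ s, P b) = ∑ b ∈ s, fdiff i k u v (P b) := by
  simp only [fdiff, substVar, map_sum, Finset.mul_sum]
  rw [Finset.sum_comm]

lemma foldr_fdiff_sum {M : ℕ} (n : Fin M → ℕ) (u v : Fin M → ℂ) (l : List (Fin M))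
    {β : Type*} (s : Finset β) (P : β → MvPolynomial (Fin M) ℂ) :
    l.foldr (fun i Q => fdiff i (n i) (u i) (v i) Q) (∑ b ∈ s, P b) =
      ∑ b ∈ s, l.foldr (fun i Q => fdiff i (n i) (u i) (v i) Q) (P b) := by
  induction l with
  | nil => rfl
  | cons i l ih => simp only [List.foldr_cons, ih, fdiff_sum]

lemma foldr_fdiff_monomial {M : ℕ} (n : Fin M → ℕ) (u v : Fin M → ℂ) (l : List (Fin M))
    (hl : l.Nodup) (a : Fin M →₀ ℕ) (c : ℂ) :
    l.foldr (fun i Q => fdiff i (n i) (u i) (v i) Q) (MvPolynomial.monomial a c) =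
      MvPolynomial.monomial (a.filter (fun j => j ∉ l))
        (c * ∏ i ∈ l.toFinset, dl (n i) (a i) (u i) (v i)) := by
  induction l with
  | nil =>
    have : a.filter (fun j => j ∉ ([] : List (Fin M))) = a := by ext j; simp
    rw [this]
    simp
  | cons i l ih =>
    rw [List.nodup_cons] at hl
    rw [List.foldr_cons, ih hl.2, fdiff_monomial, List.toFinset_cons,
      Finset.prod_insert (by simpa using hl.1)]
    congr 1
    · congr 1
      ext j
      by_cases hj : j = i
      · subst hj; simp
      · simp [Finsupp.erase_ne hj, Finsupp.filter_apply, hj]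
    · simp [hl.1]
      ring

lemma foldr_fdiff_eq {M : ℕ} (n : Fin M → ℕ) (u v : Fin M → ℂ) (huv : ∀ i, u i ≠ v i)
    (P : MvPolynomial (Fin M) ℂ)
    (hP : ∀ a : Fin M →₀ ℕ, ∑ i, n i < ∑ i, a i → MvPolynomial.coeff a P = 0) :
    (List.finRange M).foldr (fun i Q => fdiff i (n i) (u i) (v i) Q) P =
      MvPolynomial.C ((∏ i, ((n i).factorial : ℂ)) *
        MvPolynomial.coeff (Finsupp.equivFunOnFinite.symm n) P) := by
  conv_lhs => rw [P.as_sum]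
  rw [foldr_fdiff_sum]
  simp only [foldr_fdiff_monomial n u v _ (List.nodup_finRange M)]
  have h0 : ∀ a : Fin M →₀ ℕ, a.filter (fun j => j ∉ List.finRange M) = 0 := by
    intro a; ext j; simp
  have h1 : (List.finRange M).toFinset = Finset.univ := by ext; simp
  simp only [h0, h1]
  rw [Finset.sum_eq_single (Finsupp.equivFunOnFinite.symm n)]
  · rw [MvPolynomial.C_apply]
    congr 1
    simp only [Finsupp.equivFunOnFinite_symm_apply_apply]
    rw [Finset.prod_congr rfl fun i _ => dl_self (n i) (u i) (v i) (huv i), mul_comm]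
  · intro a ha hne
    have : ∃ i, a i < n i := by
      by_contra! hcon
      rw [MvPolynomial.mem_support_iff] at ha
      apply ha
      apply hP
      by_contra! hle
      apply hne
      ext i
      have := (Finset.sum_eq_sum_iff_of_le (fun i _ => hcon i)).1
        (le_antisymm (Finset.sum_le_sum fun i _ => hcon i) hle) i (Finset.mem_univ i)
      simpa using this.symm
    obtain ⟨i, hi⟩ := this
    rw [Finset.prod_eq_zero (Finset.mem_univ i) (dl_lt _ _ (huv i) hi)]
    simp
  · intro h
    rw [MvPolynomial.notMem_support_iff] at h
    simp [h]

/-- additive derivations of a commutative ring (fixing the instance path) -/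
abbrev DerZ (S : Type*) [CommRing S] := Derivation ℤ S S

/-- constructor from an additive map -/
def derMk {S : Type*} [CommRing S] (f : S →+ S) (h : ∀ a b, f (a * b) = a * f b + b * f a) :
    DerZ S :=
  Derivation.mk' f.toIntLinearMap (fun a b => by simpa using h a b)

lemma derMk_apply {S : Type*} [CommRing S] (f : S →+ S)
    (h : ∀ a b, f (a * b) = a * f b + b * f a) (a : S) : derMk f h a = f a := rfl

lemma der_leib {S : Type*} [CommRing S] (D : DerZ S) (a b : S) :
    D (a * b) = a * D b + b * D a := by
  simp [Derivation.leibniz]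

lemma der_leib_pow {S : Type*} [CommRing S] (D : DerZ S) (a : S) (n : ℕ) :
    D (a ^ n) = n * (a ^ (n - 1) * D a) := by
  simp [Derivation.leibniz_pow]

section LfSec
variable {α : Type*} [LinearOrder α] [Fintype α] {S : Type*} [CommRing S]

/-- loop Hafnian restricted to a finset of indices -/
def Lf (B : α → α → S) (t : Finset α) : S :=
  ∑ σ ∈ Finset.univ.filter (fun σ : Equiv.Perm α => σ * σ = 1 ∧ ∀ i, i ∉ t → σ i = i),
    ∏ i ∈ t.filter (fun i => i ≤ σ i), B i (σ i)

lemma Lf_empty (B : α → α → S) : Lf B ∅ = 1 := by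
  unfold Lf
  have : Finset.univ.filter
      (fun σ : Equiv.Perm α => σ * σ = 1 ∧ ∀ i, i ∉ (∅ : Finset α) → σ i = i) = {1} := by
    ext σ
    simp only [Finset.mem_filter, Finset.mem_univ, true_and, Finset.notMem_empty,
      not_false_eq_true, forall_true_left, Finset.mem_singleton]
    constructor
    · rintro ⟨_, h⟩
      ext i
      simpa using h i
    · rintro rfl
      simp
  rw [this]
  simp

lemma invol_apply {σ : Equiv.Perm α} (h : σ * σ = 1) (i : α) : σ (σ i) = i := by
  have := congrArg (fun τ : Equiv.Perm α => τ i) h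
  simpa using this

lemma prod_split (B : α → α → S) (hB : ∀ i j, B i j = B j i) (t : Finset α) (a b : α)
    (ha : a ∈ t) (hb : b ∈ t) (σ τ : Equiv.Perm α) (hab : σ a = b) (hba : σ b = a)
    (hτ : ∀ i, i ≠ a → i ≠ b → τ i = σ i) :
    ∏ i ∈ t.filter (fun i => i ≤ σ i), B i (σ i) =
      B a b * ∏ i ∈ ((t.erase a).erase b).filter (fun i => i ≤ τ i), B i (τ i) := by
  rw [Finset.prod_filter, Finset.prod_filter, ← Finset.mul_prod_erase t _ ha]
  have h2 : ∏ i ∈ (t.erase a).erase b, (if i ≤ τ i then B i (τ i) else 1)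
      = ∏ i ∈ (t.erase a).erase b, (if i ≤ σ i then B i (σ i) else 1) := by
    refine Finset.prod_congr rfl fun i hi => ?_
    simp only [Finset.mem_erase] at hi
    rw [hτ i hi.2.1 hi.1]
  rw [h2, hab]
  by_cases e : b = a
  · subst e
    simp
  · have hb' : b ∈ t.erase a := Finset.mem_erase.2 ⟨e, hb⟩
    rw [← Finset.mul_prod_erase (t.erase a) _ hb', hba, ← mul_assoc]
    congr 1
    rcases lt_or_gt_of_ne e with h | h
    · rw [if_neg (not_le.2 h), if_pos h.le, one_mul, hB]
    · rw [if_pos h.le, if_neg (not_le.2 h), mul_one]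

lemma Lf_fiber (B : α → α → S) (hB : ∀ i j, B i j = B j i) (t : Finset α) (a b : α)
    (ha : a ∈ t) (hb : b ∈ t) :
    ∑ σ ∈ (Finset.univ.filter
        (fun σ : Equiv.Perm α => σ * σ = 1 ∧ ∀ i, i ∉ t → σ i = i)).filter (fun σ => σ a = b),
      ∏ i ∈ t.filter (fun i => i ≤ σ i), B i (σ i) = B a b * Lf B ((t.erase a).erase b) := by
  rw [Lf, Finset.mul_sum]
  refine Finset.sum_nbij' (fun σ => σ * Equiv.swap a b) (fun σ => σ * Equiv.swap a b)
    ?_ ?_ ?_ ?_ ?_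
  · intro σ hσ
    simp only [Finset.mem_filter, Finset.mem_univ, true_and] at hσ ⊢
    obtain ⟨⟨h1, h2⟩, h3⟩ := hσ
    have h4 : σ b = a := by rw [← h3]; exact invol_apply h1 a
    have h5 := invol_apply h1
    have hn : ∀ i, i ≠ a → i ≠ b → (σ * Equiv.swap a b) i = σ i := by
      intro i h h'
      simp [Equiv.swap_apply_of_ne_of_ne h h']
    have hA : (σ * Equiv.swap a b) a = a := by simp [h4]
    have hBb : (σ * Equiv.swap a b) b = b := by simp [h3]
    constructor
    · ext i
      rw [Equiv.Perm.mul_apply, Equiv.Perm.one_apply]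
      by_cases e1 : i = a
      · rw [e1, hA, hA]
      by_cases e2 : i = b
      · rw [e2, hBb, hBb]
      rw [hn i e1 e2, hn, h5]
      · intro h; apply e2; rw [← h5 i, h, h3]
      · intro h; apply e1; rw [← h5 i, h, h4]
    · intro i hi
      by_cases e1 : i = a
      · rw [e1, hA]
      by_cases e2 : i = b
      · rw [e2, hBb]
      rw [hn i e1 e2]
      apply h2
      intro hh
      apply hi
      simp [e1, e2, hh]
  · intro σ hσ
    simp only [Finset.mem_filter, Finset.mem_univ, true_and] at hσ ⊢
    obtain ⟨h1, h2⟩ := hσ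
    have ha' : σ a = a := h2 a (by simp)
    have hb' : σ b = b := h2 b (by simp)
    have h5 := invol_apply h1
    have hn : ∀ i, i ≠ a → i ≠ b → (σ * Equiv.swap a b) i = σ i := by
      intro i h h'
      simp [Equiv.swap_apply_of_ne_of_ne h h']
    have hA : (σ * Equiv.swap a b) a = b := by simp [hb']
    have hBb : (σ * Equiv.swap a b) b = a := by simp [ha']
    refine ⟨⟨?_, ?_⟩, hA⟩
    · ext i
      rw [Equiv.Perm.mul_apply, Equiv.Perm.one_apply]
      by_cases e1 : i = a
      · rw [e1, hA, hBb]
      by_cases e2 : i = b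
      · rw [e2, hBb, hA]
      rw [hn i e1 e2, hn, h5]
      · intro h; exact e1 (σ.injective (h.trans ha'.symm))
      · intro h; exact e2 (σ.injective (h.trans hb'.symm))
    · intro i hi
      have e1 : i ≠ a := fun h => hi (h ▸ ha)
      have e2 : i ≠ b := fun h => hi (h ▸ hb)
      rw [hn i e1 e2]
      apply h2
      simp [hi]
  · intro σ _
    simp [mul_assoc]
  · intro σ _
    simp [mul_assoc]
  · intro σ hσ
    simp only [Finset.mem_filter, Finset.mem_univ, true_and] at hσ
    obtain ⟨⟨h1, h2⟩, h3⟩ := hσ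
    have h4 : σ b = a := by rw [← h3]; exact invol_apply h1 a
    refine prod_split B hB t a b ha hb _ _ h3 h4 ?_
    intro i h h'
    simp [Equiv.swap_apply_of_ne_of_ne h h']

lemma Lf_rec (B : α → α → S) (hB : ∀ i j, B i j = B j i) (t : Finset α) (a : α) (ha : a ∉ t) :
    Lf B (insert a t) = B a a * Lf B t + ∑ b ∈ t, B a b * Lf B (t.erase b) := by
  have hm : ∀ σ ∈ (Finset.univ.filter
        (fun σ : Equiv.Perm α => σ * σ = 1 ∧ ∀ i, i ∉ insert a t → σ i = i)),
      σ a ∈ insert a t := by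
    intro σ hσ
    simp only [Finset.mem_filter, Finset.mem_univ, true_and] at hσ
    by_contra hcon
    have := hσ.2 _ hcon
    have h2 := σ.injective this
    rw [h2] at hcon
    simp at hcon
  conv_lhs => rw [Lf]
  rw [← Finset.sum_fiberwise_of_maps_to hm, Finset.sum_insert ha,
    Lf_fiber B hB _ a a (by simp) (by simp)]
  congr 1
  · simp [Finset.erase_insert ha, Finset.erase_eq_of_notMem ha]
  · refine Finset.sum_congr rfl fun b hb => ?_
    rw [Lf_fiber B hB _ a b (by simp) (by simp [hb]), Finset.erase_insert ha]

lemma Lf_deriv (B : α → α → S) (hB : ∀ i j, B i j = B j i) (D : DerZ S) (w : S)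
    (p q : α) (hpq : p ≠ q) (t : Finset α) (hp : p ∉ t) (hq : q ∉ t)
    (h1 : ∀ i ∈ t, D (B i i) = w * (B i p * B q q + B i q * B p p))
    (h2 : ∀ i ∈ t, ∀ j ∈ t, i ≠ j → D (B i j) = w * (B i p * B q j + B i q * B p j)) :
    D (Lf B t) = w * Lf B (insert p (insert q t)) - w * (B p q + B p p * B q q) * Lf B t := by
  induction t using Finset.strongInduction with
  | H t ih =>
    rcases t.eq_empty_or_nonempty with rfl | ⟨a, hat⟩
    · rw [Lf_rec B hB _ p (by simpa using hpq), Lf_rec B hB _ q (by simp)]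
      simp [Lf_empty]
      ring
    · obtain ⟨s, has, rfl⟩ : ∃ s, a ∉ s ∧ insert a s = t :=
        ⟨t.erase a, by simp, Finset.insert_erase hat⟩
      simp only [Finset.mem_insert, not_or] at hp hq
      have hsub : ∀ b, s.erase b ⊂ insert a s := fun b =>
        (Finset.erase_subset _ _).trans_ssubset (Finset.ssubset_insert has)
      have ih1 := ih s (Finset.ssubset_insert has) hp.2 hq.2
        (fun i hi => h1 i (Finset.mem_insert_of_mem hi))
        (fun i hi j hj => h2 i (Finset.mem_insert_of_mem hi) j (Finset.mem_insert_of_mem hj))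
      have ih2 : ∀ b ∈ s, D (Lf B (s.erase b)) = _ := fun b _ =>
        ih (s.erase b) (hsub b) (fun h => hp.2 (Finset.mem_of_mem_erase h))
          (fun h => hq.2 (Finset.mem_of_mem_erase h))
          (fun i hi => h1 i (Finset.mem_insert_of_mem (Finset.mem_of_mem_erase hi)))
          (fun i hi j hj => h2 i (Finset.mem_insert_of_mem (Finset.mem_of_mem_erase hi)) j
            (Finset.mem_insert_of_mem (Finset.mem_of_mem_erase hj)))
      have e1 : insert p (insert q (insert a s)) = insert a (insert p (insert q s)) := by
        ext x; simp; tauto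
      have hps : p ∉ insert q s := by simp [hpq, hp.2]
      rw [e1, Lf_rec B hB (insert p (insert q s)) a (by simp [has, Ne.symm hp.1, Ne.symm hq.1]), Lf_rec B hB s a has,
        Finset.sum_insert hps, Finset.sum_insert hq.2, Finset.erase_insert hps]
      have e2 : (insert p (insert q s)).erase q = insert p s := by
        ext x; simp only [Finset.mem_erase, Finset.mem_insert]
        constructor
        · tauto
        · rintro (rfl | h)
          · exact ⟨hpq, Or.inl rfl⟩
          · exact ⟨fun h' => hq.2 (h' ▸ h), Or.inr (Or.inr h)⟩
      have e3 : ∀ b ∈ s, (insert p (insert q s)).erase b = insert p (insert q (s.erase b)) := by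
        intro b hb
        have : b ≠ p := fun h' => hp.2 (h' ▸ hb)
        have : b ≠ q := fun h' => hq.2 (h' ▸ hb)
        ext x; simp only [Finset.mem_erase, Finset.mem_insert]
        constructor
        · tauto
        · rintro (rfl | rfl | h) <;> tauto
      rw [e2, Lf_rec B hB s q hq.2, Lf_rec B hB s p hp.2]
      have e5 : ∑ b ∈ s, B a b * Lf B ((insert p (insert q s)).erase b) =
          ∑ b ∈ s, B a b * Lf B (insert p (insert q (s.erase b))) :=
        Finset.sum_congr rfl (fun b hb => by rw [e3 b hb])
      rw [e5]
      rw [map_add, D.leibniz, map_sum, ih1, h1 a (by simp)]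
      have e4 : ∑ b ∈ s, D (B a b * Lf B (s.erase b)) =
          ∑ b ∈ s, (w * (B a b * Lf B (insert p (insert q (s.erase b))))
            - w * (B p q + B p p * B q q) * (B a b * Lf B (s.erase b))
            + (w * B a p * (B q b * Lf B (s.erase b))
            + w * B a q * (B p b * Lf B (s.erase b)))) := by
        refine Finset.sum_congr rfl fun b hb => ?_
        rw [D.leibniz, ih2 b hb, h2 a (by simp) b (by simp [hb]) (fun h => has (h ▸ hb))]
        simp only [smul_eq_mul]
        ring
      rw [e4]
      simp only [Finset.sum_add_distrib, Finset.sum_sub_distrib, ← Finset.mul_sum, smul_eq_mul]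
      ring

end LfSec

section PsSec
open PowerSeries
variable {R : Type*} [CommRing R]

/-- coefficientwise derivation on power series -/
def psD (δ : DerZ R) : DerZ R⟦X⟧ :=
  derMk
    { toFun := fun f => PowerSeries.mk fun n => δ (coeff n f)
      map_zero' := by ext n; simp
      map_add' := fun f g => by ext n; simp }
    (by
      intro f g
      ext n
      simp only [AddMonoidHom.coe_mk, ZeroHom.coe_mk, coeff_mk, coeff_mul, map_sum,
        map_add, der_leib, Finset.sum_add_distrib]
      congr 1
      rw [← Finset.Nat.sum_antidiagonal_swap]
      rfl)

@[simp] lemma coeff_psD (δ : DerZ R) (f : R⟦X⟧) (n : ℕ) :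
    coeff n (psD δ f) = δ (coeff n f) := by
  simp [psD, derMk_apply]

lemma psD_X (δ : DerZ R) : psD δ (X : R⟦X⟧) = 0 := by
  ext n
  simp only [coeff_psD, coeff_X, map_zero]
  split_ifs <;> simp

lemma psD_C (δ : DerZ R) (r : R) : psD δ (C r : R⟦X⟧) = C (δ r) := by
  ext n
  simp only [coeff_psD, coeff_C]
  split_ifs <;> simp

lemma psD_X_mul (δ : DerZ R) (f : R⟦X⟧) : psD δ (X * f) = X * psD δ f := by
  simp [der_leib, psD_X]

lemma inv_natCast_mul (hU : ∀ m : ℕ, m ≠ 0 → IsUnit (m : R)) {m : ℕ} (hm : m ≠ 0) :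
    Ring.inverse (m : R) * m = 1 := Ring.inverse_mul_cancel _ (hU m hm)

lemma deriv_inv_natCast (hU : ∀ m : ℕ, m ≠ 0 → IsUnit (m : R)) (δ : DerZ R) (m : ℕ)
    (hm : m ≠ 0) : δ (Ring.inverse (m : R)) = 0 := by
  have h := congrArg δ (inv_natCast_mul hU hm)
  simp only [der_leib, Derivation.map_natCast, Derivation.map_one_eq_zero,
    smul_eq_mul, mul_zero, zero_add] at h
  exact (hU m hm).mul_right_eq_zero.1 h

/-- partial sums of the exponential -/
def expP (c : R⟦X⟧) (J : ℕ) : R⟦X⟧ :=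
  ∑ j ∈ Finset.range (J + 1), C (Ring.inverse ((j.factorial : ℕ) : R)) * c ^ j

/-- exponential of a power series without constant term -/
def expS (c : R⟦X⟧) : R⟦X⟧ := PowerSeries.mk fun N => coeff N (expP c N)

lemma coeff_expP (c : R⟦X⟧) (hc : constantCoeff c = 0) (N J : ℕ) (h : N ≤ J) :
    coeff N (expP c J) = coeff N (expS c) := by
  rw [expS, coeff_mk]
  induction J, h using Nat.le_induction with
  | base => rfl
  | succ J hJ ih =>
    rw [← ih]
    conv_lhs => rw [expP, Finset.sum_range_succ]
    rw [map_add, ← expP, coeff_C_mul]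
    have : X ^ (J + 1) ∣ c ^ (J + 1) := pow_dvd_pow_of_dvd (X_dvd_iff.2 hc) _
    rw [X_pow_dvd_iff.1 this N (by omega)]
    simp

lemma psD_expP (hU : ∀ m : ℕ, m ≠ 0 → IsUnit (m : R)) (δ : DerZ R) (c : R⟦X⟧) (J : ℕ) :
    psD δ (expP c (J + 1)) = psD δ c * expP c J := by
  rw [expP, Finset.sum_range_succ', expP, map_add, map_sum, Finset.mul_sum]
  have h0 : psD δ (C (Ring.inverse ((Nat.factorial 0 : ℕ) : R)) * c ^ 0) = 0 := by
    simp
  rw [h0, add_zero]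
  refine Finset.sum_congr rfl fun j _ => ?_
  rw [der_leib, psD_C, deriv_inv_natCast hU δ _ (Nat.factorial_ne_zero _),
    der_leib_pow]
  simp only [map_zero, mul_zero, add_zero, smul_eq_mul, nsmul_eq_mul, Nat.add_sub_cancel]
  have h1 : Ring.inverse (((j + 1).factorial : ℕ) : R) * ((j + 1 : ℕ) : R)
      = Ring.inverse ((j.factorial : ℕ) : R) := by
    have e1 := inv_natCast_mul hU (Nat.factorial_ne_zero (j + 1))
    have e2 := inv_natCast_mul hU (Nat.factorial_ne_zero j)
    rw [Nat.factorial_succ, Nat.cast_mul] at e1 ⊢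
    linear_combination (-Ring.inverse (((j + 1 : ℕ) : R) * (j.factorial : R)) * ((j + 1 : ℕ) : R)) * e2
      + Ring.inverse (j.factorial : R) * e1
  rw [← h1, map_mul, map_natCast]
  ring

lemma psD_expS (hU : ∀ m : ℕ, m ≠ 0 → IsUnit (m : R)) (δ : DerZ R) (c : R⟦X⟧)
    (hc : constantCoeff c = 0) : psD δ (expS c) = psD δ c * expS c := by
  ext N
  rw [coeff_psD, ← coeff_expP c hc N (N + 1) (by omega), ← coeff_psD, psD_expP hU, coeff_mul,
    coeff_mul]
  refine Finset.sum_congr rfl fun x hx => ?_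
  rw [Finset.HasAntidiagonal.mem_antidiagonal] at hx
  rw [coeff_expP c hc _ _ (by omega)]

lemma coeff_zero_expS (c : R⟦X⟧) : coeff 0 (expS c) = 1 := by
  rw [expS, coeff_mk]
  simp [expP]

/-! matrices of power series -/

variable {κ : Type*} [Fintype κ] [DecidableEq κ]

lemma map_D_mul {S : Type*} [CommRing S] (D : DerZ S) (P Q : Matrix κ κ S) :
    (P * Q).map D = P.map D * Q + P * Q.map D := by
  ext a b
  simp only [Matrix.map_apply, Matrix.mul_apply, map_sum, der_leib, smul_eq_mul,
    Finset.sum_add_distrib, Matrix.add_apply]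
  rw [add_comm]
  congr 1
  exact Finset.sum_congr rfl fun _ _ => mul_comm _ _

/-- matrix-valued power series -/
def mser (f : ℕ → Matrix κ κ R) : Matrix κ κ R⟦X⟧ :=
  Matrix.of fun a b => PowerSeries.mk fun j => f j a b

lemma coeff_mser (f : ℕ → Matrix κ κ R) (a b : κ) (j : ℕ) :
    coeff j (mser f a b) = f j a b := by
  simp [mser]

lemma mser_mul (f : ℕ → Matrix κ κ R) (B : Matrix κ κ R) :
    mser f * B.map C = mser fun j => f j * B := by
  ext a b j
  simp [coeff_mser, Matrix.mul_apply]

lemma mul_mser (f : ℕ → Matrix κ κ R) (B : Matrix κ κ R) :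
    B.map C * mser f = mser fun j => B * f j := by
  ext a b j
  simp [coeff_mser, Matrix.mul_apply]

lemma mser_succ (f : ℕ → Matrix κ κ R) :
    mser f = (f 0).map C + (X : R⟦X⟧) • mser fun j => f (j + 1) := by
  ext a b j
  cases j with
  | zero => simp [coeff_mser]
  | succ j => simp [coeff_mser, coeff_succ_X_mul, coeff_C]

/-- the resolvent -/
def Kser (A W : Matrix κ κ R) : Matrix κ κ R⟦X⟧ := mser fun j => (A * W) ^ j

lemma Kser_eq (A W : Matrix κ κ R) :
    Kser A W = 1 + (X : R⟦X⟧) • (Kser A W * (A * W).map C) := by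
  rw [Kser, mser_mul]
  conv_lhs => rw [mser_succ]
  simp [pow_succ]

lemma Kser_eq' (A W : Matrix κ κ R) :
    Kser A W = 1 + (X : R⟦X⟧) • ((A * W).map C * Kser A W) := by
  rw [Kser, mul_mser]
  conv_lhs => rw [mser_succ]
  simp [pow_succ']

lemma mul_pow_shift (A W : Matrix κ κ R) (j : ℕ) : (A * W) ^ j * A = A * (W * A) ^ j := by
  induction j with
  | zero => simp
  | succ j ih => rw [pow_succ', mul_assoc, ih, pow_succ']; simp only [mul_assoc]

lemma Kser_transpose (A W : Matrix κ κ R) (hA : Aᵀ = A) (hW : Wᵀ = W) :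
    (Kser A W)ᵀ = 1 + (X : R⟦X⟧) • (W.map C * Kser A W * A.map C) := by
  have h : (Kser A W)ᵀ = mser fun j => (W * A) ^ j := by
    ext a b j
    have : ((A * W) ^ j)ᵀ = (W * A) ^ j := by
      rw [Matrix.transpose_pow, Matrix.transpose_mul, hA, hW]
    have h2 := congrFun (congrFun this a) b
    rw [coeff_mser, ← h2, Matrix.transpose_apply, Matrix.transpose_apply, Kser, coeff_mser]
  rw [h, Kser, mul_mser, mser_mul, mser_succ]
  simp only [pow_zero]
  congr 1
  · simp
  · congr 2
    ext1 j
    rw [mul_assoc, mul_pow_shift, pow_succ', mul_assoc]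

lemma Kser_deriv (A W : Matrix κ κ R) (D : DerZ R⟦X⟧) (hX : D X = 0) :
    (Kser A W).map D = (X : R⟦X⟧) • (Kser A W * ((A * W).map C).map D * Kser A W) := by
  set K := Kser A W with hK
  set T := (A * W).map (C : R →+* R⟦X⟧) with hT
  have h1 : K = 1 + (X : R⟦X⟧) • (K * T) := Kser_eq A W
  have h2 : K = 1 + (X : R⟦X⟧) • (T * K) := Kser_eq' A W
  have h3 : K.map D = (X : R⟦X⟧) • (K.map D * T + K * T.map D) := by
    conv_lhs => rw [h1]
    rw [← map_D_mul]
    ext1 a b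
    simp only [Matrix.map_apply, Matrix.add_apply, Matrix.smul_apply, map_add, smul_eq_mul,
      der_leib, hX, mul_zero, add_zero, mul_zero]
    rw [add_eq_right, Matrix.one_apply]
    split_ifs <;> simp
  have h4 : K.map D = K.map D * K - (X : R⟦X⟧) • (K.map D * T * K) := by
    conv_lhs => rw [← mul_one (K.map D)]
    rw [eq_sub_of_add_eq h2.symm, mul_sub, mul_assoc, Matrix.mul_smul]
  have h5 : K.map D * K = (X : R⟦X⟧) • (K.map D * T * K + K * T.map D * K) := by
    conv_lhs => rw [h3]
    rw [Matrix.smul_mul, add_mul]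
  rw [h4, h5, smul_add, add_sub_cancel_left]

/-- transformed matrix -/
def apS (A W : Matrix κ κ R) : Matrix κ κ R⟦X⟧ := Kser A W * A.map C

/-- transformed vector -/
def gpS (A W : Matrix κ κ R) (γ : κ → R) : κ → R⟦X⟧ := Kser A W *ᵥ (fun a => C (γ a))

lemma apS_eq (A W : Matrix κ κ R) : apS A W = mser fun j => (A * W) ^ j * A := by
  rw [apS, Kser, mser_mul]

lemma apS_symm (A W : Matrix κ κ R) (hA : Aᵀ = A) (hW : Wᵀ = W) (a b : κ) :
    apS A W a b = apS A W b a := by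
  rw [apS_eq]
  ext j
  rw [coeff_mser, coeff_mser, ← Matrix.transpose_apply ((A * W) ^ j * A)]
  congr 1
  rw [Matrix.transpose_mul, Matrix.transpose_pow, Matrix.transpose_mul, hA, hW, mul_pow_shift]

variable (A W : Matrix κ κ R) (γ : κ → R) (δ : DerZ R) (P Q : κ)

lemma map_C_D (B : Matrix κ κ R) : (B.map (C : R →+* R⟦X⟧)).map (psD δ) = (B.map δ).map C := by
  ext1 a b
  simp [psD_C]

/-- symmetric elementary matrix -/
def Eel (S : Type*) [CommRing S] (P Q : κ) : Matrix κ κ S :=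
  Matrix.single P Q 1 + Matrix.single Q P 1

lemma Eel_map : (Eel R P Q).map (C : R →+* R⟦X⟧) = Eel R⟦X⟧ P Q := by
  ext1 a b
  simp only [Eel, Matrix.map_apply, Matrix.add_apply, map_add, Matrix.single_apply]
  split_ifs <;> simp

lemma mul_Eel_mul {S : Type*} [CommRing S] (Y Z : Matrix κ κ S) (a b : κ) :
    (Y * Eel S P Q * Z) a b = Y a P * Z Q b + Y a Q * Z P b := by
  rw [Eel, mul_add, add_mul, Matrix.add_apply]
  simp [Matrix.mul_apply, Matrix.single_apply, Finset.sum_mul, ite_and]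

lemma Eel_bilin {S : Type*} [CommRing S] (x y : κ → S) :
    x ⬝ᵥ (Eel S P Q *ᵥ y) = x P * y Q + x Q * y P := by
  rw [Eel, Matrix.add_mulVec, dotProduct_add]
  simp [Matrix.mulVec, dotProduct, Matrix.single_apply, ite_and]

lemma AW_deriv (hδA : ∀ a b, δ (A a b) = 0) (hδW : W.map δ = Eel R P Q) :
    ((A * W).map (C : R →+* R⟦X⟧)).map (psD δ) = A.map C * Eel R⟦X⟧ P Q := by
  rw [map_C_D, map_D_mul, hδW]
  have : A.map δ = 0 := by ext a b; simp [hδA]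
  rw [this, zero_mul, zero_add, Matrix.map_mul, Eel_map]

lemma Kser_deriv' (hδA : ∀ a b, δ (A a b) = 0) (hδW : W.map δ = Eel R P Q) :
    (Kser A W).map (psD δ) = (X : R⟦X⟧) • (apS A W * Eel R⟦X⟧ P Q * Kser A W) := by
  rw [Kser_deriv A W _ (psD_X δ), AW_deriv A W δ P Q hδA hδW, apS]
  simp only [mul_assoc]

lemma apS_deriv (hδA : ∀ a b, δ (A a b) = 0) (hδW : W.map δ = Eel R P Q) (a b : κ) :
    psD δ (apS A W a b) =
      X * (apS A W a P * apS A W Q b + apS A W a Q * apS A W P b) := by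
  have h : (apS A W).map (psD δ) = (X : R⟦X⟧) • (apS A W * Eel R⟦X⟧ P Q * apS A W) := by
    conv_lhs => rw [apS]
    have h0 : A.map δ = 0 := by ext a b; simp [hδA]
    rw [map_D_mul, map_C_D, h0, Kser_deriv' A W δ P Q hδA hδW, Matrix.smul_mul]
    simp [apS, mul_assoc]
  have := congrFun (congrFun h a) b
  rw [Matrix.smul_apply, mul_Eel_mul] at this
  simpa using this

lemma gpS_deriv (hδA : ∀ a b, δ (A a b) = 0) (hδγ : ∀ a, δ (γ a) = 0)
    (hδW : W.map δ = Eel R P Q) (a : κ) :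
    psD δ (gpS A W γ a) =
      X * (apS A W a P * gpS A W γ Q + apS A W a Q * gpS A W γ P) := by
  have h := Kser_deriv' A W δ P Q hδA hδW
  have h' : ∀ b, psD δ (Kser A W a b) = X * (apS A W a P * Kser A W Q b
      + apS A W a Q * Kser A W P b) := by
    intro b
    have := congrFun (congrFun h a) b
    rw [Matrix.smul_apply, mul_Eel_mul] at this
    simpa using this
  simp only [gpS, Matrix.mulVec, dotProduct, map_sum, der_leib, psD_C, hδγ, map_zero,
    mul_zero, zero_add, h', smul_eq_mul, Finset.mul_sum, ← Finset.sum_add_distrib]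
  refine Finset.sum_congr rfl fun b _ => ?_
  ring

/-- the exponent -/
def cS : R⟦X⟧ := PowerSeries.mk fun j => if j = 0 then 0 else
  Ring.inverse ((2 * j : ℕ) : R) * Matrix.trace ((W * A) ^ j)
    + Ring.inverse (2 : R) * (γ ⬝ᵥ Matrix.mulVec ((W * A) ^ (j - 1) * W) γ)

lemma trace_deriv (B : Matrix κ κ R) (j l : ℕ) :
    Matrix.trace ((B ^ j).map δ * B ^ l) = j * Matrix.trace (B ^ (j + l - 1) * B.map δ) := by
  induction j generalizing l with
  | zero =>
    have : (1 : Matrix κ κ R).map δ = 0 := by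
      ext a b
      rw [Matrix.map_apply, Matrix.one_apply]
      split_ifs <;> simp
    simp [this]
  | succ j ih =>
    rw [pow_succ, map_D_mul, add_mul, Matrix.trace_add, mul_assoc, ← pow_succ', ih,
      Matrix.trace_mul_comm (B ^ j * B.map δ), ← mul_assoc, ← pow_add]
    have e1 : j + (l + 1) - 1 = j + l := by omega
    have e2 : j + 1 + l - 1 = j + l := by omega
    rw [e1, e2, add_comm l j]
    push_cast
    ring

lemma trace_deriv' (B : Matrix κ κ R) (j : ℕ) :
    δ (Matrix.trace (B ^ (j + 1))) = (j + 1 : ℕ) * Matrix.trace (B ^ j * B.map δ) := by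
  have := trace_deriv δ B (j + 1) 0
  simp only [pow_zero, mul_one, add_zero, Nat.add_sub_cancel] at this
  rw [← this]
  simp [Matrix.trace]

lemma cS_eq : cS A W γ =
    (PowerSeries.mk fun j => if j = 0 then 0 else
      Ring.inverse ((2 * j : ℕ) : R) * Matrix.trace ((W * A) ^ j)) +
    C (Ring.inverse (2 : R)) * (X * ((fun a => C (γ a)) ⬝ᵥ
      ((W.map C * Kser A W) *ᵥ (fun a => C (γ a))))) := by
  rw [Kser, mul_mser]
  ext j
  cases j with
  | zero => simp [cS]
  | succ j =>
    rw [map_add, coeff_C_mul, coeff_succ_X_mul, cS, coeff_mk, coeff_mk, if_neg (by omega),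
      if_neg (by omega), Nat.add_sub_cancel, mul_pow_shift]
    congr 2
    simp [dotProduct, Matrix.mulVec, coeff_mser, coeff_C_mul, coeff_mul_C]

lemma cS_deriv (hU : ∀ m : ℕ, m ≠ 0 → IsUnit (m : R)) (hA : Aᵀ = A) (hW : Wᵀ = W)
    (hδA : ∀ a b, δ (A a b) = 0) (hδγ : ∀ a, δ (γ a) = 0) (hδW : W.map δ = Eel R P Q) :
    psD δ (cS A W γ) = X * (apS A W P Q + gpS A W γ P * gpS A W γ Q) := by
  have h2 : Ring.inverse (2 : R) * 2 = 1 := by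
    have := inv_natCast_mul hU (m := 2) (by norm_num)
    simpa using this
  have hi2 : δ (Ring.inverse (2 : R)) = 0 := by
    have := deriv_inv_natCast hU δ 2 (by norm_num)
    simpa using this
  have h0 : A.map δ = 0 := by ext a b; simp [hδA]
  have hT : psD δ (PowerSeries.mk fun j => if j = 0 then 0 else
      Ring.inverse ((2 * j : ℕ) : R) * Matrix.trace ((W * A) ^ j)) = X * apS A W P Q := by
    ext j
    cases j with
    | zero => simp
    | succ j =>
      rw [coeff_psD, coeff_mk, if_neg (by omega), coeff_succ_X_mul, der_leib,
        deriv_inv_natCast hU δ _ (by omega), trace_deriv', map_D_mul, h0, mul_zero, add_zero,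
        hδW, Matrix.trace_mul_comm, mul_assoc (Eel R P Q), Matrix.trace_mul_comm (Eel R P Q),
        ← mul_pow_shift]
      have hs : ((A * W) ^ j * A) Q P = ((A * W) ^ j * A) P Q := by
        have := congrArg (coeff j) (apS_symm A W hA hW Q P)
        rwa [apS_eq, coeff_mser, coeff_mser] at this
      have ht : Matrix.trace (((A * W) ^ j * A) * Eel R P Q) = 2 * ((A * W) ^ j * A) P Q := by
        rw [Eel, mul_add, Matrix.trace_add]
        simp only [Matrix.trace, Matrix.diag, Matrix.mul_apply, Matrix.single_apply]
        simp only [← Matrix.mul_apply]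
        simp [ite_and, hs]
        ring
      rw [ht, apS_eq, coeff_mser, mul_zero, add_zero]
      have := inv_natCast_mul hU (m := 2 * (j + 1)) (by omega)
      push_cast at this ⊢
      linear_combination ((A * W) ^ j * A) P Q * this
  have hq : psD δ ((fun a => C (γ a)) ⬝ᵥ ((W.map C * Kser A W) *ᵥ (fun a => C (γ a))))
      = 2 * (gpS A W γ P * gpS A W γ Q) := by
    set g : κ → R⟦X⟧ := fun a => C (γ a) with hg
    have e1 : ∀ Y : Matrix κ κ R⟦X⟧, psD δ (g ⬝ᵥ (Y *ᵥ g)) = g ⬝ᵥ (Y.map (psD δ) *ᵥ g) := by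
      intro Y
      simp [dotProduct, Matrix.mulVec, map_sum, der_leib, hg, psD_C, hδγ, mul_comm]
    rw [e1, map_D_mul, map_C_D, hδW, Eel_map, Kser_deriv' A W δ P Q hδA hδW]
    have e2 : Eel R⟦X⟧ P Q * Kser A W + W.map C * ((X : R⟦X⟧) • (apS A W * Eel R⟦X⟧ P Q * Kser A W))
        = (Kser A W)ᵀ * (Eel R⟦X⟧ P Q * Kser A W) := by
      rw [Kser_transpose A W hA hW, add_mul, one_mul, apS]
      simp only [Matrix.mul_smul, Matrix.smul_mul, mul_assoc]
    rw [e2, ← Matrix.mulVec_mulVec, ← Matrix.mulVec_mulVec, Matrix.dotProduct_mulVec,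
      Matrix.vecMul_transpose, Eel_bilin, gpS]
    ring
  rw [cS_eq, map_add, hT, der_leib, psD_C, hi2, psD_X_mul, hq]
  simp only [map_zero, mul_zero, add_zero, smul_eq_mul]
  have h2' : (C (Ring.inverse (2 : R)) : R⟦X⟧) * 2 = 1 := by
    have := congrArg (C : R →+* R⟦X⟧) h2
    rwa [map_mul, map_one, map_ofNat] at this
  linear_combination (X * (gpS A W γ P * gpS A W γ Q)) * h2'

end PsSec

section Assembly

lemma mv_unit (M : ℕ) (m : ℕ) (hm : m ≠ 0) : IsUnit ((m : ℕ) : MvPolynomial (Fin M) ℂ) := by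
  have h : IsUnit ((m : ℕ) : ℂ) := by
    rw [isUnit_iff_ne_zero]
    exact_mod_cast hm
  have := h.map (MvPolynomial.C : ℂ →+* MvPolynomial (Fin M) ℂ)
  rwa [map_natCast] at this

/-- the partial derivative as an additive derivation -/
def dz {M : ℕ} (k : Fin M) : DerZ (MvPolynomial (Fin M) ℂ) :=
  derMk (MvPolynomial.pderiv k : Derivation ℂ _ _).toLinearMap.toAddMonoidHom
    (fun a b => by simp [Derivation.leibniz])

lemma dz_apply {M : ℕ} (k : Fin M) (p : MvPolynomial (Fin M) ℂ) :
    dz k p = MvPolynomial.pderiv k p := rfl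

/-- the matrix `D(z) X` over polynomials -/
def Wz (M : ℕ) : Matrix (Fin M ⊕ Fin M) (Fin M ⊕ Fin M) (MvPolynomial (Fin M) ℂ) :=
  Dmat (fun i => (MvPolynomial.X i : MvPolynomial (Fin M) ℂ)) *
    Xmat (Fin M) (MvPolynomial (Fin M) ℂ)

lemma Wz_apply (M : ℕ) (a b : Fin M ⊕ Fin M) :
    Wz M a b = (Sum.elim (fun i => MvPolynomial.X i) (fun i => MvPolynomial.X i) a) *
      Xmat (Fin M) (MvPolynomial (Fin M) ℂ) a b := by
  rw [Wz, Dmat, Matrix.diagonal_mul]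

lemma Wz_symm (M : ℕ) : (Wz M)ᵀ = Wz M := by
  ext1 a b
  rw [Matrix.transpose_apply, Wz_apply, Wz_apply]
  rcases a with a | a <;> rcases b with b | b <;> simp [Xmat, Matrix.one_apply] <;>
  · by_cases h : a = b
    · simp [h]
    · simp [h, Ne.symm h]

lemma Wz_deriv (M : ℕ) (k : Fin M) :
    (Wz M).map (dz k) = Eel (MvPolynomial (Fin M) ℂ) (Sum.inl k) (Sum.inr k) := by
  ext1 a b
  rw [Matrix.map_apply, Wz_apply, dz_apply, Eel, Matrix.add_apply, Matrix.single_apply,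
    Matrix.single_apply]
  rcases a with a | a <;> rcases b with b | b <;> simp [Xmat, Matrix.one_apply] <;>
  · by_cases h : a = b
    · subst h
      by_cases h' : a = k
      · subst h'
        simp
      · simp [MvPolynomial.pderiv_X_of_ne h', Ne.symm h']
    · simp only [h, if_false, map_zero]
      symm
      rw [if_neg]
      rintro ⟨rfl, rfl⟩
      exact h rfl

lemma fN_eq {ι : Type*} [Fintype ι] [DecidableEq ι] {R : Type*} [CommRing R]
    (N : ℕ) (A : Matrix (ι ⊕ ι) (ι ⊕ ι) R) (γ : ι ⊕ ι → R) (z : ι → R) :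
    fN N A γ z = PowerSeries.coeff N (expS (cS A (Dmat z * Xmat ι R) γ)) := by
  set c := cS A (Dmat z * Xmat ι R) γ with hc
  set p : Polynomial R :=
    ∑ k ∈ Finset.Icc 1 N, Polynomial.C (gfun A γ z k) * Polynomial.X ^ k with hp
  have hdiv : (PowerSeries.X : PowerSeries R) ^ (N + 1) ∣ (p : PowerSeries R) - c := by
    rw [PowerSeries.X_pow_dvd_iff]
    intro m hm
    rw [map_sub, Polynomial.coeff_coe, hp, Polynomial.finsetSum_coeff]
    simp only [Polynomial.coeff_C_mul_X_pow]
    rw [Finset.sum_ite_eq, hc, cS, PowerSeries.coeff_mk]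
    by_cases h0 : m = 0
    · simp [h0]
    · rw [if_pos (by simp; omega), if_neg h0, gfun, sub_self]
  rw [expS, PowerSeries.coeff_mk, fN, ← hp, expP, Polynomial.finsetSum_coeff, map_sum]
  refine Finset.sum_congr rfl fun j _ => ?_
  rw [Polynomial.coeff_C_mul, PowerSeries.coeff_C_mul]
  congr 1
  have h := hdiv.trans (sub_dvd_pow_sub_pow (p : PowerSeries R) c j)
  rw [PowerSeries.X_pow_dvd_iff] at h
  have := h N (by omega)
  rw [map_sub, sub_eq_zero, ← Polynomial.coe_pow, Polynomial.coeff_coe] at this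
  exact this

lemma Lf_map {α : Type*} [LinearOrder α] [Fintype α] {S T : Type*} [CommRing S] [CommRing T]
    (f : S →+* T) (B : α → α → S) (t : Finset α) :
    f (Lf B t) = Lf (fun i j => f (B i j)) t := by
  simp [Lf, map_sum, map_prod]

/-- labelled index set built from a list of pair indices -/
def tset {N : ℕ} (I : List (Fin N)) : Finset (Fin (N + N)) :=
  I.foldr (fun i t => insert (Fin.castAdd N i) (insert (Fin.natAdd N i) t)) ∅

lemma castAdd_ne_natAdd {N : ℕ} (i j : Fin N) : Fin.castAdd N i ≠ Fin.natAdd N j := by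
  intro h
  have := congrArg Fin.val h
  simp at this
  omega

lemma tset_cons {N : ℕ} (i : Fin N) (I : List (Fin N)) :
    tset (i :: I) = insert (Fin.castAdd N i) (insert (Fin.natAdd N i) (tset I)) := rfl

lemma mem_tset_left {N : ℕ} (I : List (Fin N)) (i : Fin N) :
    Fin.castAdd N i ∈ tset I ↔ i ∈ I := by
  induction I with
  | nil => simp [tset]
  | cons j I ih =>
    have e : Fin.castAdd N i = Fin.castAdd N j ↔ i = j := (Fin.castAdd_injective N N).eq_iff
    rw [tset_cons, Finset.mem_insert, Finset.mem_insert, ih, List.mem_cons, e]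
    simp only [castAdd_ne_natAdd, false_or]

lemma mem_tset_right {N : ℕ} (I : List (Fin N)) (i : Fin N) :
    Fin.natAdd N i ∈ tset I ↔ i ∈ I := by
  induction I with
  | nil => simp [tset]
  | cons j I ih =>
    have e : Fin.natAdd N i = Fin.natAdd N j ↔ i = j := (Fin.natAdd_injective N N).eq_iff
    have e2 : ¬ (Fin.natAdd N i = Fin.castAdd N j) := (castAdd_ne_natAdd j i).symm
    rw [tset_cons, Finset.mem_insert, Finset.mem_insert, ih, List.mem_cons, e]
    simp only [e2, false_or]

lemma tset_finRange (N : ℕ) : tset (List.finRange N) = Finset.univ := by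
  ext x
  simp only [Finset.mem_univ, iff_true]
  refine Fin.addCases (fun i => ?_) (fun i => ?_) x
  · simp [mem_tset_left]
  · rw [mem_tset_right]; exact List.mem_finRange i

/-- labels of the doubled index set -/
def lab {M N : ℕ} (r : Fin N → Fin M) : Fin (N + N) → Fin M ⊕ Fin M :=
  Sum.map r r ∘ finSumFinEquiv.symm

lemma lab_left {M N : ℕ} (r : Fin N → Fin M) (i : Fin N) :
    lab r (Fin.castAdd N i) = Sum.inl (r i) := by simp [lab]

lemma lab_right {M N : ℕ} (r : Fin N → Fin M) (i : Fin N) :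
    lab r (Fin.natAdd N i) = Sum.inr (r i) := by
  rw [lab, Function.comp_apply, finSumFinEquiv_symm_apply_natAdd]; rfl

/-- matrix with overwritten diagonal -/
def fillB {α κ S : Type*} [DecidableEq α] (φ : α → κ) (A : Matrix κ κ S) (γ : κ → S) :
    α → α → S :=
  fun i j => if i = j then γ (φ i) else A (φ i) (φ j)

lemma fillB_self {α κ S : Type*} [DecidableEq α] (φ : α → κ) (A : Matrix κ κ S) (γ : κ → S)
    (i : α) : fillB φ A γ i i = γ (φ i) := by simp [fillB]

lemma fillB_ne {α κ S : Type*} [DecidableEq α] (φ : α → κ) (A : Matrix κ κ S) (γ : κ → S)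
    {i j : α} (h : i ≠ j) : fillB φ A γ i j = A (φ i) (φ j) := by simp [fillB, h]

lemma iter_deriv {M N : ℕ} (A : Matrix (Fin M ⊕ Fin M) (Fin M ⊕ Fin M) ℂ) (hA : Aᵀ = A)
    (γ : Fin M ⊕ Fin M → ℂ) (r : Fin N → Fin M) (I : List (Fin N)) (hI : I.Nodup) :
    I.foldr (fun i Q => psD (dz (r i)) Q)
        (expS (cS (A.map MvPolynomial.C) (Wz M) (fun x => MvPolynomial.C (γ x)))) =
      PowerSeries.X ^ I.length *
        (expS (cS (A.map MvPolynomial.C) (Wz M) (fun x => MvPolynomial.C (γ x))) *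
        Lf (fillB (lab r) (apS (A.map MvPolynomial.C) (Wz M))
          (gpS (A.map MvPolynomial.C) (Wz M) (fun x => MvPolynomial.C (γ x)))) (tset I)) := by
  set A' : Matrix (Fin M ⊕ Fin M) (Fin M ⊕ Fin M) (MvPolynomial (Fin M) ℂ) :=
    A.map MvPolynomial.C with hA'
  set γ' : Fin M ⊕ Fin M → MvPolynomial (Fin M) ℂ := fun x => MvPolynomial.C (γ x) with hγ'
  have hsA : A'ᵀ = A' := by
    rw [hA', ← Matrix.transpose_map, hA]
  have hδA : ∀ k a b, dz k (A' a b) = 0 := by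
    intro k a b
    simp [hA', dz_apply]
  have hδγ : ∀ k a, dz k (γ' a) = 0 := by
    intro k a
    simp [hγ', dz_apply]
  set F := expS (cS A' (Wz M) γ') with hF
  set B := fillB (lab r) (apS A' (Wz M)) (gpS A' (Wz M) γ') with hB
  have hBs : ∀ i j, B i j = B j i := by
    intro i j
    by_cases h : i = j
    · rw [h]
    · rw [hB, fillB_ne _ _ _ h, fillB_ne _ _ _ (Ne.symm h), apS_symm A' (Wz M) hsA (Wz_symm M)]
  induction I with
  | nil => simp [tset, Lf_empty]
  | cons k I ih =>
    rw [List.nodup_cons] at hI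
    rw [List.foldr_cons, ih hI.2, tset_cons, List.length_cons]
    have hDF : psD (dz (r k)) F = PowerSeries.X * (apS A' (Wz M) (Sum.inl (r k)) (Sum.inr (r k))
        + gpS A' (Wz M) γ' (Sum.inl (r k)) * gpS A' (Wz M) γ' (Sum.inr (r k))) * F := by
      rw [hF, psD_expS (mv_unit M) _ _ (by simp [cS]),
        cS_deriv A' (Wz M) γ' (dz (r k)) _ _ (mv_unit M) hsA (Wz_symm M) (hδA _) (hδγ _)
          (Wz_deriv M (r k))]
    have hp : Fin.castAdd N k ∉ tset I := by rw [mem_tset_left]; exact hI.1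
    have hq : Fin.natAdd N k ∉ tset I := by rw [mem_tset_right]; exact hI.1
    have hpq := castAdd_ne_natAdd k k
    have hDL := Lf_deriv B hBs (psD (dz (r k))) PowerSeries.X (Fin.castAdd N k) (Fin.natAdd N k)
      hpq (tset I) hp hq
      (by
        intro i hi
        have hip : i ≠ Fin.castAdd N k := fun h => hp (h ▸ hi)
        have hiq : i ≠ Fin.natAdd N k := fun h => hq (h ▸ hi)
        rw [hB, fillB_self, fillB_self, fillB_self, fillB_ne _ _ _ hip, fillB_ne _ _ _ hiq,
          lab_left, lab_right]
        exact gpS_deriv A' (Wz M) γ' _ _ _ (hδA _) (hδγ _) (Wz_deriv M (r k)) _)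
      (by
        intro i hi j hj hij
        have hip : i ≠ Fin.castAdd N k := fun h => hp (h ▸ hi)
        have hiq : i ≠ Fin.natAdd N k := fun h => hq (h ▸ hi)
        have hjp : Fin.castAdd N k ≠ j := fun h => hp (h ▸ hj)
        have hjq : Fin.natAdd N k ≠ j := fun h => hq (h ▸ hj)
        rw [hB, fillB_ne _ _ _ hij, fillB_ne _ _ _ hip, fillB_ne _ _ _ hiq, fillB_ne _ _ _ hjp,
          fillB_ne _ _ _ hjq, lab_left, lab_right]
        exact apS_deriv A' (Wz M) _ _ _ (hδA _) (Wz_deriv M (r k)) _ _)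
    have hb1 : B (Fin.castAdd N k) (Fin.natAdd N k) =
        apS A' (Wz M) (Sum.inl (r k)) (Sum.inr (r k)) := by
      rw [hB, fillB_ne _ _ _ hpq, lab_left, lab_right]
    have hb2 : B (Fin.castAdd N k) (Fin.castAdd N k) = gpS A' (Wz M) γ' (Sum.inl (r k)) := by
      rw [hB, fillB_self, lab_left]
    have hb3 : B (Fin.natAdd N k) (Fin.natAdd N k) = gpS A' (Wz M) γ' (Sum.inr (r k)) := by
      rw [hB, fillB_self, lab_right]
    rw [hb1, hb2, hb3] at hDL
    rw [der_leib, der_leib_pow, psD_X, der_leib, hDF, hDL]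
    ring

lemma coeff_foldr_psD {M N : ℕ} (r : Fin N → Fin M) (I : List (Fin N)) (m : ℕ)
    (F : PowerSeries (MvPolynomial (Fin M) ℂ)) :
    PowerSeries.coeff m (I.foldr (fun i Q => psD (dz (r i)) Q) F) =
      (I.map r).foldr (fun k p => MvPolynomial.pderiv k p) (PowerSeries.coeff m F) := by
  induction I with
  | nil => rfl
  | cons i I ih => simp only [List.foldr_cons, List.map_cons, coeff_psD, ih, dz_apply]

lemma coeff_foldr_pderiv {M : ℕ} (J : List (Fin M)) (p : MvPolynomial (Fin M) ℂ)
    (b : Fin M →₀ ℕ) :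
    (∏ k, ((b k).factorial : ℂ)) *
        MvPolynomial.coeff b (J.foldr (fun k p => MvPolynomial.pderiv k p) p) =
      (∏ k, ((b k + J.count k).factorial : ℂ)) *
        MvPolynomial.coeff (b + Finsupp.equivFunOnFinite.symm (fun k => J.count k)) p := by
  induction J generalizing b with
  | nil =>
    have : (Finsupp.equivFunOnFinite.symm (fun k => ([] : List (Fin M)).count k)) = 0 := by
      ext k; simp
    rw [this]
    simp
  | cons i J ih =>
    rw [List.foldr_cons, MvPolynomial.coeff_pderiv]
    have h := ih (b + Finsupp.single i 1)
    have e1 : (∏ k, (((b + Finsupp.single i 1 : Fin M →₀ ℕ) k).factorial : ℂ)) =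
        (∏ k, ((b k).factorial : ℂ)) * (b i + 1) := by
      rw [← Finset.mul_prod_erase _ _ (Finset.mem_univ i),
        ← Finset.mul_prod_erase Finset.univ (fun k => ((b k).factorial : ℂ)) (Finset.mem_univ i)]
      have : ∀ k ∈ Finset.univ.erase i, (((b + Finsupp.single i 1 : Fin M →₀ ℕ) k).factorial : ℂ)
          = ((b k).factorial : ℂ) := by
        intro k hk
        have hk := Finset.ne_of_mem_erase hk
        simp [Finsupp.single_apply, Ne.symm hk]
      rw [Finset.prod_congr rfl this]
      simp [Nat.factorial_succ]
      ring
    have e2 : b + Finsupp.single i 1 + Finsupp.equivFunOnFinite.symm (fun k => J.count k) =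
        b + Finsupp.equivFunOnFinite.symm (fun k => (i :: J).count k) := by
      ext k
      by_cases hk : i = k
      · subst hk
        simp
        ring
      · simp [hk, Finsupp.single_apply]
    have e3 : ∀ k, (b + Finsupp.single i 1 : Fin M →₀ ℕ) k + J.count k = b k + (i :: J).count k := by
      intro k
      have := congrArg (fun f : Fin M →₀ ℕ => f k) e2
      simpa using this
    rw [e1, e2] at h
    simp only [e3] at h
    rw [← h]
    ring

lemma map_rep {M : ℕ} (n : Fin M → ℕ) : (List.finRange (∑ k, n k)).map (rep n) = repList n := by
  apply List.ext_getElem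
  · simp [repList_length]
  · intro i h1 h2
    simp [rep]

lemma count_repList {M : ℕ} (n : Fin M → ℕ) (k : Fin M) : (repList n).count k = n k := by
  rw [repList, List.count_flatMap, ← Fin.sum_univ_def]
  simp [Function.comp, List.count_replicate]

lemma coeff_zero_Lf {M : ℕ} (A : Matrix (Fin M ⊕ Fin M) (Fin M ⊕ Fin M) ℂ)
    (γ : Fin M ⊕ Fin M → ℂ) (n : Fin M → ℕ) :
    PowerSeries.constantCoeff (Lf (fillB (lab (rep n)) (apS (A.map MvPolynomial.C) (Wz M))
          (gpS (A.map MvPolynomial.C) (Wz M) (fun x => MvPolynomial.C (γ x)))) Finset.univ) =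
      MvPolynomial.C (lhafv (repMat A n n) (repVec γ n n)) := by
  have hL : lhafv (repMat A n n) (repVec γ n n) = Lf (fillB (lab (rep n)) A γ) Finset.univ := by
    rw [lhafv, lhaf, Lf]
    simp only [Finset.mem_univ, not_true_eq_false, false_imp_iff, implies_true, and_true]
    rfl
  rw [hL, Lf_map, Lf_map]
  congr 1
  funext i j
  have hK : ∀ a b, PowerSeries.constantCoeff (Kser (A.map MvPolynomial.C) (Wz M) a b)
      = (1 : Matrix (Fin M ⊕ Fin M) (Fin M ⊕ Fin M) (MvPolynomial (Fin M) ℂ)) a b := by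
    intro a b
    rw [← PowerSeries.coeff_zero_eq_constantCoeff_apply, Kser, coeff_mser, pow_zero]
  by_cases h : i = j
  · subst h
    rw [fillB_self, fillB_self]
    simp [gpS, Matrix.mulVec, dotProduct, hK, Matrix.one_apply, -Fintype.sum_sum_type]
  · rw [fillB_ne _ _ _ h, fillB_ne _ _ _ h]
    simp [apS, Matrix.mul_apply, hK, Matrix.one_apply, -Fintype.sum_sum_type]

lemma key_coeff {M : ℕ} (A : Matrix (Fin M ⊕ Fin M) (Fin M ⊕ Fin M) ℂ) (hA : Aᵀ = A)
    (γ : Fin M ⊕ Fin M → ℂ) (n : Fin M → ℕ) (m : ℕ) (hm : m ≤ ∑ k, n k) :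
    (∏ k, ((n k).factorial : ℂ)) * MvPolynomial.coeff (Finsupp.equivFunOnFinite.symm n)
      (fN m (A.map MvPolynomial.C) (fun x => MvPolynomial.C (γ x))
          (fun i => (MvPolynomial.X i : MvPolynomial (Fin M) ℂ))) =
      if m = ∑ k, n k then lhafv (repMat A n n) (repVec γ n n) else 0 := by
  have h1 := iter_deriv A hA γ (rep n) (List.finRange _) (List.nodup_finRange _)
  have h2 := congrArg (PowerSeries.coeff m) h1
  rw [coeff_foldr_psD, map_rep, tset_finRange, List.length_finRange] at h2
  have h3 := coeff_foldr_pderiv (repList n)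
    (fN m (A.map MvPolynomial.C) (fun x => MvPolynomial.C (γ x))
          (fun i => (MvPolynomial.X i : MvPolynomial (Fin M) ℂ))) 0
  simp only [count_repList, Finsupp.coe_zero, Pi.zero_apply, zero_add, Nat.factorial_zero,
    Nat.cast_one, Finset.prod_const_one, one_mul] at h3
  rw [← h3, fN_eq]
  change MvPolynomial.coeff 0 (List.foldr _ (PowerSeries.coeff m (expS (cS _ (Wz M) _))) _) = _
  rw [h2, PowerSeries.coeff_X_pow_mul']
  by_cases h : m = ∑ k, n k
  · rw [if_pos h.ge, if_pos h, h, Nat.sub_self, PowerSeries.coeff_zero_eq_constantCoeff_apply,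
      map_mul, coeff_zero_Lf, ← PowerSeries.coeff_zero_eq_constantCoeff_apply, coeff_zero_expS,
      one_mul, MvPolynomial.coeff_zero_C]
  · rw [if_neg (by omega), if_neg h, MvPolynomial.coeff_zero]

end Assembly

/-- Finite-difference sieve for loop Hafnians: regarding `f_N(A,γ,z)` as a polynomial in
the variables `z_1,…,z_M`, for any choices of parameters `u_i ≠ v_i` one has
`lhaf(A_{n⊕n}, γ_{n⊕n}) = (Π_i D_{z_i}^{(n_i)}) f_N(A,γ,z)` (the right-hand side is a
constant polynomial). -/
theorem finite_difference_sieve_lhaf (M : ℕ) (hM : 1 ≤ M)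
    (A : Matrix (Fin M ⊕ Fin M) (Fin M ⊕ Fin M) ℂ) (hA : A.IsSymm)
    (γ : Fin M ⊕ Fin M → ℂ) (n : Fin M → ℕ)
    (u v : Fin M → ℂ) (huv : ∀ i, u i ≠ v i) :
    (List.finRange M).foldr (fun i Q => fdiff i (n i) (u i) (v i) Q)
        (fN (∑ i, n i) (A.map MvPolynomial.C) (fun x => MvPolynomial.C (γ x))
          (fun i => (MvPolynomial.X i : MvPolynomial (Fin M) ℂ)))
      = MvPolynomial.C (lhafv (repMat A n n) (repVec γ n n)) := by
  rw [foldr_fdiff_eq n u v huv]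
  · rw [key_coeff A hA γ n _ le_rfl, if_pos rfl]
  · intro a ha
    have h := key_coeff A hA γ a (∑ i, n i) ha.le
    rw [if_neg ha.ne] at h
    rcases mul_eq_zero.1 h with h | h
    · exfalso
      rw [Finset.prod_eq_zero_iff] at h
      obtain ⟨i, _, hi⟩ := h
      exact Nat.factorial_ne_zero _ (by exact_mod_cast hi)
    · simpa using h

end
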